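/- arXiv:2305.15625 — 2 statements merged into one kernel-verified Lean document; each statement's English description precedes it below -/
import Mathlib

section
/- Let G = (V, E) be a finite simple claw-free graph containing a simplicial clique K_s, with an operator realization and a simplicial mode χ with respect to K_s. Then for every u ∈ ℂ, the following anticommutation identity holds: (T_G(−u)·χ·T_G(u))·χ + χ·(T_G(−u)·χ·T_G(u)) = 2·(2·T_{G[V \ K_s]}(u)·T_{G[V \ K_s]}(−u) − T_G(u)·T_G(−u)). (Established in the proof of Lemma 18.) -/
open scoped Classical

universe u

/-- `G` is claw-free: no vertex has three pairwise distinct, pairwise non-adjacent neighbors. -/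
def ClawFree {V : Type u} (G : SimpleGraph V) : Prop :=
  ¬ ∃ c x y z : V, x ≠ y ∧ x ≠ z ∧ y ≠ z ∧
    G.Adj c x ∧ G.Adj c y ∧ G.Adj c z ∧ ¬ G.Adj x y ∧ ¬ G.Adj x z ∧ ¬ G.Adj y z

/-- `S` is an independent set of `G`. -/
def IsIndep {V : Type u} (G : SimpleGraph V) (S : Finset V) : Prop :=
  ∀ u ∈ S, ∀ v ∈ S, ¬ G.Adj u v

/-- The product `h(S) = ∏_{v ∈ S} h v`, well defined when the factors pairwise commute. -/
noncomputable def hProd {V : Type u} {d : ℕ} (h : V → Matrix (Fin d) (Fin d) ℂ)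
    (S : Finset V) : Matrix (Fin d) (Fin d) ℂ :=
  if hc : (S : Set V).Pairwise fun u v => Commute (h u) (h v) then S.noncommProd h hc
  else 0

/-- The transfer operator `T_{G[U]}(u) = Σ_S (−u)^{|S|}·h(S)`, summed over all independent
sets `S ⊆ U` of `G`. -/
noncomputable def transferOp {V : Type u} {d : ℕ} [Fintype V] [DecidableEq V]
    (G : SimpleGraph V) (h : V → Matrix (Fin d) (Fin d) ℂ) (U : Finset V) (u : ℂ) :
    Matrix (Fin d) (Fin d) ℂ :=
  ∑ S ∈ Finset.univ.filter (fun S : Finset V => S ⊆ U ∧ IsIndep G S),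
    (-u) ^ S.card • hProd h S

/-- `K` is a simplicial clique of `G`: a clique such that, for every `j ∈ K`, the set of
neighbors of `j` outside `K` is a clique. -/
def IsSimplicialClique {V : Type u} (G : SimpleGraph V) (K : Finset V) : Prop :=
  (∀ u ∈ K, ∀ v ∈ K, u ≠ v → G.Adj u v) ∧
    ∀ j ∈ K, ∀ u v : V, u ∉ K → v ∉ K → u ≠ v → G.Adj j u → G.Adj j v → G.Adj u v

/-- The number of ordered pairs in `S × T` that are adjacent in `G`. -/
noncomputable def crossEdges {V : Type u} (G : SimpleGraph V) (S T : Finset V) : ℕ :=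
  ∑ x ∈ S, ∑ y ∈ T, if G.Adj x y then 1 else 0

section Graph

variable {V : Type u} {G : SimpleGraph V}

theorem crossEdges_comm (S T : Finset V) : crossEdges G S T = crossEdges G T S := by
  unfold crossEdges
  rw [Finset.sum_comm]
  simp only [G.adj_comm]

theorem crossEdges_eq_zero {S T : Finset V} (hn : ∀ x ∈ S, ∀ y ∈ T, ¬ G.Adj x y) :
    crossEdges G S T = 0 :=
  Finset.sum_eq_zero fun x hx => Finset.sum_eq_zero fun y hy => if_neg (hn x hx y hy)

theorem crossEdges_self_eq_two_mul (C : Finset V) :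
    crossEdges G C C = 2 * (G.induce (C : Set V)).edgeFinset.card := by
  rw [← SimpleGraph.sum_degrees_eq_twice_card_edges, crossEdges, ← Finset.sum_coe_sort C]
  refine Finset.sum_congr rfl fun x _ => ?_
  rw [← Finset.sum_coe_sort C, ← SimpleGraph.card_neighborFinset_eq_degree,
    SimpleGraph.neighborFinset_eq_filter, Finset.card_filter]
  rfl

theorem IsIndep.mono {S T : Finset V} (hT : IsIndep G T) (hST : S ⊆ T) : IsIndep G S :=
  fun x hx y hy => hT x (hST hx) y (hST hy)

theorem ClawFree.sum_adj_le_two (hcf : ClawFree G) {T : Finset V} (hT : IsIndep G T) (x : V) :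
    (∑ y ∈ T, if G.Adj x y then 1 else 0) ≤ 2 := by
  rw [← Finset.card_filter]
  by_contra! hlt
  obtain ⟨a, ha, b, hb, c, hc, hab, hac, hbc⟩ := Finset.two_lt_card.1 hlt
  rw [Finset.mem_filter] at ha hb hc
  exact hcf ⟨x, a, b, c, hab, hac, hbc, ha.2, hb.2, hc.2, hT a ha.1 b hb.1, hT a ha.1 c hc.1,
    hT b hb.1 c hc.1⟩

variable [DecidableEq V]

theorem crossEdges_union_left {A B : Finset V} (T : Finset V) (hd : Disjoint A B) :
    crossEdges G (A ∪ B) T = crossEdges G A T + crossEdges G B T :=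
  Finset.sum_union hd

theorem crossEdges_union_right {A B : Finset V} (T : Finset V) (hd : Disjoint A B) :
    crossEdges G T (A ∪ B) = crossEdges G T A + crossEdges G T B := by
  rw [crossEdges_comm, crossEdges_union_left T hd, crossEdges_comm A, crossEdges_comm B]

theorem crossEdges_union_self {A B : Finset V} (hd : Disjoint A B) :
    crossEdges G (A ∪ B) (A ∪ B) =
      crossEdges G A A + crossEdges G B B + 2 * crossEdges G A B := by
  rw [crossEdges_union_left _ hd, crossEdges_union_right _ hd, crossEdges_union_right _ hd,
    crossEdges_comm B A]
  ring

/-- A property of finite vertex sets that passes to a part of every edgeless bipartition passes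
from `D` to a connected component of `G[D]`. -/
theorem exists_component (Q : Finset V → Prop)
    (hQ : ∀ A B : Finset V, Disjoint A B → (∀ x ∈ A, ∀ y ∈ B, ¬ G.Adj x y) →
      Q (A ∪ B) → Q A ∨ Q B) (D : Finset V) (hD : Q D) :
    ∃ C ⊆ D, (∀ x ∈ C, ∀ y ∈ D, G.Adj x y → y ∈ C) ∧ Q C ∧
      2 * C.card ≤ crossEdges G C C + 2 := by
  induction D using Finset.strongInduction with
  | H D ih =>
  have of_part : ∀ A ⊂ D, (∀ x ∈ A, ∀ y ∈ D, G.Adj x y → y ∈ A) → Q A →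
      ∃ C ⊆ D, (∀ x ∈ C, ∀ y ∈ D, G.Adj x y → y ∈ C) ∧ Q C ∧
        2 * C.card ≤ crossEdges G C C + 2 := by
    intro A hA hcl hQA
    obtain ⟨C, hC, hC1, hC2, hC3⟩ := ih A hA hQA
    exact ⟨C, hC.trans hA.subset, fun x hx y hy hxy => hC1 x hx y (hcl x (hC hx) y hy hxy) hxy,
      hC2, hC3⟩
  by_cases hpre : (G.induce (D : Set V)).Preconnected
  · refine ⟨D, subset_rfl, fun _ _ _ hy _ => hy, hD, ?_⟩
    rcases D.eq_empty_or_nonempty with rfl | ⟨x, hx⟩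
    · simp
    · have hc : (G.induce (D : Set V)).Connected :=
        { preconnected := hpre, nonempty := ⟨⟨x, hx⟩⟩ }
      have := hc.card_vert_le_card_edgeSet_add_one
      rw [crossEdges_self_eq_two_mul]
      rw [Nat.card_eq_fintype_card, Nat.card_eq_fintype_card, ← SimpleGraph.edgeFinset_card] at this
      simp only [Finset.coe_sort_coe, Fintype.card_coe] at this
      omega
  · simp only [SimpleGraph.Preconnected, not_forall] at hpre
    obtain ⟨x, y, hxy⟩ := hpre
    let A : Finset V := D.filter fun z => ∃ hz : z ∈ (D : Set V),
      (G.induce (D : Set V)).Reachable x ⟨z, hz⟩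
    have hAD : A ⊆ D := Finset.filter_subset _ _
    have hxA : (x : V) ∈ A := Finset.mem_filter.2 ⟨x.2, x.2, SimpleGraph.Reachable.refl _⟩
    have hyA : (y : V) ∉ A := fun hy => by
      obtain ⟨_, _, h⟩ := Finset.mem_filter.1 hy
      exact hxy h
    have hcl : ∀ a ∈ A, ∀ b ∈ D, G.Adj a b → b ∈ A := by
      intro a ha b hb hab
      obtain ⟨ha, _, h⟩ := Finset.mem_filter.1 ha
      refine Finset.mem_filter.2 ⟨hb, hb, h.trans (SimpleGraph.Adj.reachable ?_)⟩
      exact hab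
    have hu : A ∪ (D \ A) = D := Finset.union_sdiff_of_subset hAD
    rcases hQ A (D \ A) Finset.disjoint_sdiff
      (fun a ha b hb hab => (Finset.mem_sdiff.1 hb).2 (hcl a ha b (Finset.mem_sdiff.1 hb).1 hab))
      (hu.symm ▸ hD) with h | h
    · exact of_part A ⟨hAD, fun hs => hyA (hs y.2)⟩ hcl h
    · refine of_part (D \ A) ⟨Finset.sdiff_subset, fun hs => ?_⟩ ?_ h
      · exact (Finset.mem_sdiff.1 (hs x.2)).2 hxA
      · intro a ha b hb hab
        rw [Finset.mem_sdiff] at ha ⊢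
        exact ⟨hb, fun hbA => ha.2 (hcl b hbA a ha.1 hab.symm)⟩

theorem symmDiff_eq_sdiff_union_inter {S T C : Finset V} (hC : C ⊆ symmDiff S T) :
    symmDiff S C = S \ C ∪ T ∩ C := by
  ext x
  have := @hC x
  simp only [Finset.mem_symmDiff, Finset.mem_union, Finset.mem_sdiff, Finset.mem_inter] at this ⊢
  tauto

theorem card_symmDiff_eq {S T C : Finset V} (hC : C ⊆ symmDiff S T) :
    (symmDiff S C).card + (S ∩ C).card = S.card + (T ∩ C).card := by
  rw [symmDiff_eq_sdiff_union_inter hC, Finset.card_union_of_disjoint]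
  · have := Finset.card_sdiff_add_card_inter S C
    omega
  · exact Finset.disjoint_of_subset_right Finset.inter_subset_right Finset.sdiff_disjoint

theorem IsIndep.symmDiff {S T C : Finset V} (hS : IsIndep G S) (hT : IsIndep G T)
    (hC : C ⊆ symmDiff S T) (hcl : ∀ x ∈ C, ∀ y ∈ symmDiff S T, G.Adj x y → y ∈ C) :
    IsIndep G (symmDiff S C) := by
  have key : ∀ x ∈ S \ C, ∀ y ∈ T ∩ C, ¬ G.Adj x y := by
    intro x hx y hy hxy
    rw [Finset.mem_sdiff] at hx
    rw [Finset.mem_inter] at hy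
    refine hx.2 (hcl y hy.2 x ?_ hxy.symm)
    exact Finset.mem_symmDiff.2 (Or.inl ⟨hx.1, fun hxT => hT x hxT y hy.1 hxy⟩)
  rw [symmDiff_eq_sdiff_union_inter hC]
  intro x hx y hy hxy
  rcases Finset.mem_union.1 hx with hx | hx <;> rcases Finset.mem_union.1 hy with hy | hy
  · exact hS x (Finset.mem_sdiff.1 hx).1 y (Finset.mem_sdiff.1 hy).1 hxy
  · exact key x hx y hy hxy
  · exact key y hy x hx hxy.symm
  · exact hT x (Finset.mem_inter.1 hx).1 y (Finset.mem_inter.1 hy).1 hxy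

theorem card_inter_add_card_inter {S T C : Finset V} (hC : C ⊆ symmDiff S T) :
    (S ∩ C).card + (T ∩ C).card = C.card := by
  rw [← Finset.card_union_of_disjoint]
  · congr 1
    ext x
    have := @hC x
    simp only [Finset.mem_symmDiff, Finset.mem_union, Finset.mem_inter] at this ⊢
    tauto
  · rw [Finset.disjoint_left]
    intro x hx hx'
    have := hC (Finset.mem_inter.1 hx).2
    simp only [Finset.mem_symmDiff, Finset.mem_inter] at this hx hx'
    tauto

theorem crossEdges_self_of_subset_symmDiff {S T C : Finset V} (hS : IsIndep G S)
    (hT : IsIndep G T) (hC : C ⊆ symmDiff S T) :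
    crossEdges G C C = 2 * crossEdges G (S ∩ C) (T ∩ C) := by
  have hu : C = S ∩ C ∪ T ∩ C := by
    ext x
    have := @hC x
    simp only [Finset.mem_symmDiff, Finset.mem_union, Finset.mem_inter] at this ⊢
    tauto
  have hd : Disjoint (S ∩ C) (T ∩ C) := by
    rw [Finset.disjoint_left]
    intro x hx hx'
    have := hC (Finset.mem_inter.1 hx).2
    simp only [Finset.mem_symmDiff, Finset.mem_inter] at this hx hx'
    tauto
  conv_lhs => rw [hu]
  rw [crossEdges_union_self hd, crossEdges_eq_zero (hS.mono Finset.inter_subset_left),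
    crossEdges_eq_zero (hT.mono Finset.inter_subset_left)]
  ring

theorem crossEdges_inter_symmDiff {S T : Finset V} (hS : IsIndep G S) (hT : IsIndep G T) :
    crossEdges G (S ∩ symmDiff S T) (T ∩ symmDiff S T) = crossEdges G S T := by
  unfold crossEdges
  refine (Finset.sum_congr rfl fun x hx => ?_).trans
    (Finset.sum_subset Finset.inter_subset_left fun x hx hx' => ?_)
  · refine Finset.sum_subset Finset.inter_subset_left fun y hy hy' => if_neg ?_
    refine hS x (Finset.mem_inter.1 hx).1 y ?_
    simp only [Finset.mem_inter, Finset.mem_symmDiff] at hy'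
    tauto
  · refine Finset.sum_eq_zero fun y hy => if_neg (hT x ?_ y hy)
    simp only [Finset.mem_inter, Finset.mem_symmDiff] at hx'
    tauto

theorem ClawFree.crossEdges_le (hcf : ClawFree G) {T : Finset V} (hT : IsIndep G T)
    (S : Finset V) : crossEdges G S T ≤ 2 * S.card := by
  refine (Finset.sum_le_card_nsmul _ _ 2 fun x _ => hcf.sum_adj_le_two hT x).trans ?_
  simp [mul_comm]

theorem ClawFree.crossEdges_lt (hcf : ClawFree G) {K : Finset V} (hK : IsSimplicialClique G K)
    {S T : Finset V} (hT : IsIndep G T) (hTK : Disjoint T K) {j : V} (hjS : j ∈ S)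
    (hjK : j ∈ K) : crossEdges G S T < 2 * S.card := by
  refine (Finset.sum_lt_sum (fun x _ => hcf.sum_adj_le_two hT x)
    ⟨j, hjS, ?_⟩).trans_le (by simp [mul_comm])
  rw [← Finset.card_filter]
  by_contra! hlt
  obtain ⟨a, ha, b, hb, hab⟩ := Finset.one_lt_card.1 (show 1 < _ from hlt)
  rw [Finset.mem_filter] at ha hb
  exact hT a ha.1 b hb.1 (hK.2 j hjK a b (Finset.disjoint_left.1 hTK ha.1)
    (Finset.disjoint_left.1 hTK hb.1) hab ha.2 hb.2)

theorem IsSimplicialClique.card_inter_le_one {K S : Finset V} (hK : IsSimplicialClique G K)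
    (hS : IsIndep G S) : (S ∩ K).card ≤ 1 := by
  refine Finset.card_le_one.2 fun a ha b hb => ?_
  rw [Finset.mem_inter] at ha hb
  by_contra hab
  exact hS a ha.1 b hb.1 (hK.1 a ha.2 b hb.2 hab)

/-- Exchanging `C` between `S` and `T` is a sign-reversing involution on pairs of independent
sets, provided `C` is a union of components of `G[S ∆ T]` determined by `S ∆ T` alone. -/
theorem sum_pairs_eq_zero [Fintype V] {M : Type*} [AddCommGroup M] [Module ℂ M]
    (U : Finset V) (F : Finset V → Finset V → M) (Good : Finset V → Finset V → Prop)
    (hsub : ∀ D C, Good D C → C ⊆ D ∧ ∀ x ∈ C, ∀ y ∈ D, G.Adj x y → y ∈ C)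
    (hex : ∀ S T, IsIndep G S → IsIndep G T → F S T ≠ 0 → ∃ C, Good (symmDiff S T) C)
    (hneg : ∀ S T C, IsIndep G S → IsIndep G T → F S T ≠ 0 → Good (symmDiff S T) C →
      F (symmDiff S C) (symmDiff T C) = - F S T) :
    ∑ S ∈ Finset.univ.filter (fun S : Finset V => S ⊆ U ∧ IsIndep G S),
      ∑ T ∈ Finset.univ.filter (fun S : Finset V => S ⊆ U ∧ IsIndep G S), F S T = 0 := by
  choose! c hc using fun (D : Finset V) (hD : ∃ C, Good D C) => hD
  rw [← Finset.sum_product', ← Finset.sum_filter_ne_zero]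
  have hgood : ∀ S T, IsIndep G S → IsIndep G T → F S T ≠ 0 →
      Good (symmDiff S T) (c (symmDiff S T)) := fun S T hS hT h => hc _ (hex S T hS hT h)
  have hinv : ∀ S T C : Finset V, symmDiff (symmDiff S C) (symmDiff T C) = symmDiff S T := by
    intro S T C
    rw [symmDiff_symmDiff_symmDiff_comm, symmDiff_self, symmDiff_bot]
  refine Finset.sum_involution
    (fun p _ => (symmDiff p.1 (c (symmDiff p.1 p.2)), symmDiff p.2 (c (symmDiff p.1 p.2))))
    ?_ ?_ ?_ ?_
  · rintro ⟨S, T⟩ hp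
    simp only [Finset.mem_filter, Finset.mem_product, Finset.mem_univ, true_and] at hp ⊢
    rw [hneg S T _ hp.1.1.2 hp.1.2.2 hp.2 (hgood S T hp.1.1.2 hp.1.2.2 hp.2), add_neg_cancel]
  · rintro ⟨S, T⟩ hp h0 heq
    simp only [Finset.mem_filter, Finset.mem_product, Finset.mem_univ, true_and] at hp h0
    have h := hneg S T _ hp.1.1.2 hp.1.2.2 hp.2 (hgood S T hp.1.1.2 hp.1.2.2 hp.2)
    simp only [Prod.mk.injEq] at heq
    rw [heq.1, heq.2] at h
    have h2 : (2 : ℂ) • F S T = 0 := by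
      rw [two_smul]
      nth_rewrite 1 [h]
      exact neg_add_cancel _
    exact h0 ((smul_eq_zero.1 h2).resolve_left two_ne_zero)
  · rintro ⟨S, T⟩ hp
    simp only [Finset.mem_filter, Finset.mem_product, Finset.mem_univ, true_and] at hp ⊢
    have hg := hgood S T hp.1.1.2 hp.1.2.2 hp.2
    have hs := hsub _ _ hg
    have hcU : c (symmDiff S T) ⊆ U := by
      intro x hx
      rcases Finset.mem_symmDiff.1 (hs.1 hx) with h | h
      · exact hp.1.1.1 h.1
      · exact hp.1.2.1 h.1
    have hsU : ∀ R ⊆ U, symmDiff R (c (symmDiff S T)) ⊆ U := by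
      intro R hR x hx
      rcases Finset.mem_symmDiff.1 hx with h | h
      · exact hR h.1
      · exact hcU h.1
    refine ⟨⟨⟨hsU S hp.1.1.1, hp.1.1.2.symmDiff hp.1.2.2 hs.1 hs.2⟩, hsU T hp.1.2.1, ?_⟩, ?_⟩
    · have hs' := hs
      nth_rewrite 2 [symmDiff_comm S T] at hs'
      nth_rewrite 3 [symmDiff_comm S T] at hs'
      exact hp.1.2.2.symmDiff hp.1.1.2 hs'.1 hs'.2
    · rw [hneg S T _ hp.1.1.2 hp.1.2.2 hp.2 hg, neg_ne_zero]
      exact hp.2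
  · rintro ⟨S, T⟩ hp
    simp only [hinv, symmDiff_symmDiff_cancel_right]

end Graph

section Operator

variable {V : Type u} {G : SimpleGraph V} {d : ℕ} {h : V → Matrix (Fin d) (Fin d) ℂ}

theorem commute_of_isIndep (hcomm : ∀ u v, u ≠ v → ¬ G.Adj u v → h u * h v = h v * h u)
    {S : Finset V} (hS : IsIndep G S) :
    (S : Set V).Pairwise fun u v => Commute (h u) (h v) :=
  fun x hx y hy hxy => hcomm x y hxy (hS x hx y hy)

theorem hProd_empty : hProd h ∅ = 1 := by
  simp [hProd]

variable [DecidableEq V]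

theorem hProd_union (hcomm : ∀ u v, u ≠ v → ¬ G.Adj u v → h u * h v = h v * h u)
    {S T : Finset V} (hST : IsIndep G (S ∪ T)) (hd : Disjoint S T) :
    hProd h (S ∪ T) = hProd h S * hProd h T := by
  have hS := commute_of_isIndep hcomm (hST.mono Finset.subset_union_left)
  have hT := commute_of_isIndep hcomm (hST.mono Finset.subset_union_right)
  rw [hProd, dif_pos (commute_of_isIndep hcomm hST), hProd, dif_pos hS, hProd, dif_pos hT,
    Finset.noncommProd_union_of_disjoint hd]

theorem hProd_insert (hcomm : ∀ u v, u ≠ v → ¬ G.Adj u v → h u * h v = h v * h u)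
    {S : Finset V} {a : V} (hS : IsIndep G (insert a S)) (ha : a ∉ S) :
    hProd h (insert a S) = h a * hProd h S := by
  rw [hProd, dif_pos (commute_of_isIndep hcomm hS), hProd,
    dif_pos (commute_of_isIndep hcomm (hS.mono (Finset.subset_insert a S))),
    Finset.noncommProd_insert_of_notMem _ _ _ _ ha]

theorem mul_hProd (hcomm : ∀ u v, u ≠ v → ¬ G.Adj u v → h u * h v = h v * h u)
    {S : Finset V} (hS : IsIndep G S) (M : Matrix (Fin d) (Fin d) ℂ) (n : V → ℕ)
    (hM : ∀ v ∈ S, M * h v = (-1 : ℂ) ^ n v • (h v * M)) :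
    M * hProd h S = (-1 : ℂ) ^ (∑ v ∈ S, n v) • (hProd h S * M) := by
  induction S using Finset.induction_on with
  | empty => simp [hProd_empty]
  | insert a S ha ih =>
    have ih := ih (hS.mono (Finset.subset_insert a S)) fun v hv =>
      hM v (Finset.mem_insert_of_mem hv)
    rw [hProd_insert hcomm hS ha, Finset.sum_insert ha, ← mul_assoc,
      hM a (Finset.mem_insert_self a S), smul_mul_assoc, mul_assoc, ih, mul_smul_comm, smul_smul,
      pow_add, mul_assoc]

theorem hProd_mul_hProd (hanti : ∀ u v, G.Adj u v → h u * h v = -(h v * h u))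
    (hcomm : ∀ u v, u ≠ v → ¬ G.Adj u v → h u * h v = h v * h u)
    {S T : Finset V} (hS : IsIndep G S) (hT : IsIndep G T) :
    hProd h T * hProd h S = (-1 : ℂ) ^ crossEdges G S T • (hProd h S * hProd h T) := by
  refine mul_hProd hcomm hS _ _ fun v _ => ?_
  have key := mul_hProd hcomm hT (h v) (fun w => if G.Adj v w then 1 else 0) fun w _ => by
    by_cases hvw : G.Adj v w
    · simp [hvw, hanti v w hvw]
    · by_cases he : v = w
      · simp [he]
      · simp [hvw, hcomm v w he hvw]
  rw [key, smul_smul, ← mul_pow]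
  simp

theorem hProd_symmDiff_mul (hanti : ∀ u v, G.Adj u v → h u * h v = -(h v * h u))
    (hcomm : ∀ u v, u ≠ v → ¬ G.Adj u v → h u * h v = h v * h u)
    {S T C : Finset V} (hS : IsIndep G S) (hT : IsIndep G T)
    (hC : C ⊆ symmDiff S T) (hcl : ∀ x ∈ C, ∀ y ∈ symmDiff S T, G.Adj x y → y ∈ C) :
    hProd h (symmDiff S C) * hProd h (symmDiff T C) =
      (-1 : ℂ) ^ crossEdges G (S ∩ C) (T ∩ C) • (hProd h S * hProd h T) := by
  have hC' : C ⊆ symmDiff T S := symmDiff_comm S T ▸ hC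
  have hcl' : ∀ x ∈ C, ∀ y ∈ symmDiff T S, G.Adj x y → y ∈ C := symmDiff_comm S T ▸ hcl
  have split : ∀ R, IsIndep G R → hProd h R = hProd h (R \ C) * hProd h (R ∩ C) := by
    intro R hR
    have hu : R \ C ∪ R ∩ C = R := Finset.sdiff_union_inter R C
    rw [← hProd_union hcomm (hu.symm ▸ hR) (Finset.disjoint_sdiff_inter R C), hu]
  have split' : ∀ R R', IsIndep G R → IsIndep G R' → C ⊆ symmDiff R R' →
      (∀ x ∈ C, ∀ y ∈ symmDiff R R', G.Adj x y → y ∈ C) →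
      hProd h (symmDiff R C) = hProd h (R \ C) * hProd h (R' ∩ C) := by
    intro R R' hR hR' hc hc'
    have hi := hR.symmDiff hR' hc hc'
    rw [symmDiff_eq_sdiff_union_inter hc] at hi ⊢
    exact hProd_union hcomm hi
      (Finset.disjoint_of_subset_right Finset.inter_subset_right Finset.sdiff_disjoint)
  have c1 : hProd h (S ∩ C) * hProd h (T \ C) = hProd h (T \ C) * hProd h (S ∩ C) := by
    rw [hProd_mul_hProd hanti hcomm (hT.mono Finset.sdiff_subset)
      (hS.mono Finset.inter_subset_left), crossEdges_eq_zero, pow_zero, one_smul]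
    intro x hx y hy hxy
    rw [Finset.mem_sdiff] at hx
    rw [Finset.mem_inter] at hy
    exact hx.2 (hcl y hy.2 x (Finset.mem_symmDiff.2
      (Or.inr ⟨hx.1, fun hxS => hS x hxS y hy.1 hxy⟩)) hxy.symm)
  have c2 : hProd h (T ∩ C) * hProd h (T \ C) = hProd h (T \ C) * hProd h (T ∩ C) := by
    rw [hProd_mul_hProd hanti hcomm (hT.mono Finset.sdiff_subset)
      (hT.mono Finset.inter_subset_left), crossEdges_eq_zero, pow_zero, one_smul]
    exact fun x hx y hy => hT x (Finset.mem_sdiff.1 hx).1 y (Finset.mem_inter.1 hy).1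
  have c3 := hProd_mul_hProd hanti hcomm (hS.mono (Finset.inter_subset_left (s₂ := C)))
    (hT.mono (Finset.inter_subset_left (s₂ := C)))
  rw [split' S T hS hT hC hcl, split' T S hT hS hC' hcl', split S hS, split T hT]
  calc _ = hProd h (S \ C) * (hProd h (T ∩ C) * hProd h (T \ C)) * hProd h (S ∩ C) := by
        simp only [mul_assoc]
    _ = hProd h (S \ C) * hProd h (T \ C) * (hProd h (T ∩ C) * hProd h (S ∩ C)) := by
        rw [c2]; simp only [mul_assoc]
    _ = (-1 : ℂ) ^ crossEdges G (S ∩ C) (T ∩ C) •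
        (hProd h (S \ C) * (hProd h (T \ C) * hProd h (S ∩ C)) * hProd h (T ∩ C)) := by
        rw [c3, mul_smul_comm]; simp only [mul_assoc]
    _ = _ := by
        rw [← c1]; simp only [mul_assoc]

theorem transferOp_mul [Fintype V] (U : Finset V) (u v : ℂ) :
    transferOp G h U u * transferOp G h U v =
      ∑ S ∈ Finset.univ.filter (fun S : Finset V => S ⊆ U ∧ IsIndep G S),
        ∑ T ∈ Finset.univ.filter (fun S : Finset V => S ⊆ U ∧ IsIndep G S),
          ((-u) ^ S.card * (-v) ^ T.card) • (hProd h S * hProd h T) := by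
  rw [transferOp, transferOp, Finset.sum_mul_sum]
  simp only [smul_mul_smul_comm]

theorem transferOp_commute [Fintype V] (hcf : ClawFree G)
    (hanti : ∀ u v, G.Adj u v → h u * h v = -(h v * h u))
    (hcomm : ∀ u v, u ≠ v → ¬ G.Adj u v → h u * h v = h v * h u)
    (U : Finset V) (u v : ℂ) :
    transferOp G h U u * transferOp G h U v = transferOp G h U v * transferOp G h U u := by
  rw [← sub_eq_zero, transferOp_mul, transferOp_mul,
    Finset.sum_comm (f := fun S T => ((-v) ^ S.card * (-u) ^ T.card) • (hProd h S * hProd h T)),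
    ← Finset.sum_sub_distrib]
  simp only [← Finset.sum_sub_distrib]
  refine sum_pairs_eq_zero (G := G) U _
    (fun D C => C ⊆ D ∧ (∀ x ∈ C, ∀ y ∈ D, G.Adj x y → y ∈ C) ∧ crossEdges G C C % 4 = 2 ∧
      2 * C.card ≤ crossEdges G C C + 2)
    (fun D C hg => ⟨hg.1, hg.2.1⟩) ?_ ?_
  · intro S T hS hT hF
    refine exists_component (G := G) (fun C => crossEdges G C C % 4 = 2) ?_ _ ?_
    · intro A B hd hn hAB
      have hA := crossEdges_self_eq_two_mul (G := G) A
      have hB := crossEdges_self_eq_two_mul (G := G) B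
      rw [crossEdges_union_self hd, crossEdges_eq_zero hn] at hAB
      omega
    · have he := crossEdges_self_of_subset_symmDiff hS hT subset_rfl
      rw [crossEdges_inter_symmDiff hS hT] at he
      rcases Nat.even_or_odd (crossEdges G S T) with hp | hp
      · refine absurd ?_ hF
        rw [hProd_mul_hProd hanti hcomm hS hT, hp.neg_one_pow, one_smul,
          mul_comm ((-v) ^ _), sub_self]
      · obtain ⟨k, hk⟩ := hp
        omega
  · rintro S T C hS hT - ⟨hC, hcl, h2, hcard⟩
    have hC' : C ⊆ symmDiff T S := symmDiff_comm S T ▸ hC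
    have hcl' : ∀ x ∈ C, ∀ y ∈ symmDiff T S, G.Adj x y → y ∈ C := symmDiff_comm S T ▸ hcl
    have he := crossEdges_self_of_subset_symmDiff hS hT hC
    have l1 := hcf.crossEdges_le (hT.mono Finset.inter_subset_left) (S ∩ C) (T := T ∩ C)
    have l2 := hcf.crossEdges_le (hS.mono Finset.inter_subset_left) (T ∩ C) (T := S ∩ C)
    rw [crossEdges_comm] at l2
    have hCc := card_symmDiff_eq hC
    have hCc' := card_symmDiff_eq hC'
    have hsum := card_inter_add_card_inter hC
    have ho : Odd (crossEdges G (S ∩ C) (T ∩ C)) := by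
      rw [Nat.odd_iff]; omega
    have e1 : (symmDiff S C).card = S.card := by
      have := Nat.odd_iff.1 ho
      omega
    have e2 : (symmDiff T C).card = T.card := by
      have := Nat.odd_iff.1 ho
      omega
    rw [hProd_symmDiff_mul hanti hcomm hS hT hC hcl,
      hProd_symmDiff_mul hanti hcomm hT hS hC' hcl', crossEdges_comm (T ∩ C), ho.neg_one_pow,
      e1, e2]
    module

theorem mode_conj_hProd (hcomm : ∀ u v, u ≠ v → ¬ G.Adj u v → h u * h v = h v * h u)
    {K : Finset V} {χ : Matrix (Fin d) (Fin d) ℂ} (hχsq : χ * χ = 1)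
    (hχanti : ∀ j ∈ K, χ * h j = -(h j * χ))
    (hχcomm : ∀ v : V, v ∉ K → χ * h v = h v * χ) {S : Finset V} (hS : IsIndep G S) :
    χ * hProd h S * χ = (-1 : ℂ) ^ (S ∩ K).card • hProd h S := by
  have key := mul_hProd hcomm hS χ (fun v => if v ∈ K then 1 else 0) fun v _ => by
    by_cases hv : v ∈ K
    · simp [hv, hχanti v hv]
    · simp [hv, hχcomm v hv]
  rw [key, smul_mul_assoc, mul_assoc, hχsq, mul_one, ← Finset.card_filter,
    Finset.filter_mem_eq_inter]

theorem two_smul_transferOp_sdiff [Fintype V]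
    (hcomm : ∀ u v, u ≠ v → ¬ G.Adj u v → h u * h v = h v * h u)
    {K : Finset V} (hK : IsSimplicialClique G K)
    {χ : Matrix (Fin d) (Fin d) ℂ} (hχsq : χ * χ = 1)
    (hχanti : ∀ j ∈ K, χ * h j = -(h j * χ))
    (hχcomm : ∀ v : V, v ∉ K → χ * h v = h v * χ) (u : ℂ) :
    (2 : ℂ) • transferOp G h (Finset.univ \ K) u =
      transferOp G h Finset.univ u + χ * transferOp G h Finset.univ u * χ := by
  simp only [transferOp, Finset.mul_sum, Finset.sum_mul, Finset.smul_sum]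
  rw [← Finset.sum_add_distrib]
  refine (Finset.sum_congr rfl fun S hS => ?_).trans
    (Finset.sum_subset (fun S hS => ?_) fun S hS hS' => ?_)
  · simp only [Finset.mem_filter, Finset.mem_univ, true_and, Finset.subset_sdiff] at hS
    rw [mul_smul_comm, smul_mul_assoc, mode_conj_hProd hcomm hχsq hχanti hχcomm hS.2,
      Finset.disjoint_iff_inter_eq_empty.1 hS.1.2]
    simp [two_smul]
  · simp only [Finset.mem_filter, Finset.mem_univ, true_and, Finset.subset_univ] at hS ⊢
    exact hS.2
  · simp only [Finset.mem_filter, Finset.mem_univ, true_and, Finset.subset_univ,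
      Finset.subset_sdiff] at hS hS'
    have h1 := hK.card_inter_le_one hS
    have h0 : (S ∩ K).card ≠ 0 := fun h0 =>
      hS' ⟨Finset.disjoint_iff_inter_eq_empty.2 (Finset.card_eq_zero.1 h0), hS⟩
    rw [mul_smul_comm, smul_mul_assoc, mode_conj_hProd hcomm hχsq hχanti hχcomm hS,
      show (S ∩ K).card = 1 by omega]
    simp

theorem mode_conj_transferOp_mul [Fintype V] (hcf : ClawFree G)
    (hanti : ∀ u v, G.Adj u v → h u * h v = -(h v * h u))
    (hcomm : ∀ u v, u ≠ v → ¬ G.Adj u v → h u * h v = h v * h u)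
    {K : Finset V} (hK : IsSimplicialClique G K)
    {χ : Matrix (Fin d) (Fin d) ℂ} (hχsq : χ * χ = 1)
    (hχanti : ∀ j ∈ K, χ * h j = -(h j * χ))
    (hχcomm : ∀ v : V, v ∉ K → χ * h v = h v * χ) (u : ℂ) :
    χ * (transferOp G h Finset.univ u * transferOp G h Finset.univ (-u)) * χ =
      transferOp G h Finset.univ u * transferOp G h Finset.univ (-u) := by
  rw [eq_comm, ← sub_eq_zero, transferOp_mul]
  simp only [Finset.mul_sum, Finset.sum_mul, ← Finset.sum_sub_distrib, mul_smul_comm,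
    smul_mul_assoc, ← smul_sub, neg_neg]
  have conj : ∀ S T, IsIndep G S → IsIndep G T → χ * (hProd h S * hProd h T) * χ =
      (-1 : ℂ) ^ ((S ∩ K).card + (T ∩ K).card) • (hProd h S * hProd h T) := by
    intro S T hS hT
    have : χ * (hProd h S * hProd h T) * χ = (χ * hProd h S * χ) * (χ * hProd h T * χ) := by
      rw [show (χ * hProd h S * χ) * (χ * hProd h T * χ) =
        χ * hProd h S * (χ * χ) * hProd h T * χ by simp only [mul_assoc], hχsq]
      simp only [mul_assoc, mul_one]
    rw [this, mode_conj_hProd hcomm hχsq hχanti hχcomm hS,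
      mode_conj_hProd hcomm hχsq hχanti hχcomm hT, smul_mul_smul_comm, pow_add]
  have parity : ∀ S T, IsIndep G S → IsIndep G T →
      ((-u) ^ S.card * u ^ T.card) • (hProd h S * hProd h T - χ * (hProd h S * hProd h T) * χ) ≠ 0 →
      (S ∩ K).card + (T ∩ K).card = 1 := by
    intro S T hS hT hF
    have h1 := hK.card_inter_le_one hS
    have h2 := hK.card_inter_le_one hT
    by_contra hne
    refine hF ?_
    have he : Even ((S ∩ K).card + (T ∩ K).card) := by
      rw [Nat.even_iff]; omega
    rw [conj S T hS hT, he.neg_one_pow, one_smul, sub_self, smul_zero]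
  refine sum_pairs_eq_zero (G := G) Finset.univ _
    (fun D C => C ⊆ D ∧ (∀ x ∈ C, ∀ y ∈ D, G.Adj x y → y ∈ C) ∧ (∃ j ∈ C, j ∈ K) ∧
      2 * C.card ≤ crossEdges G C C + 2)
    (fun D C hg => ⟨hg.1, hg.2.1⟩) ?_ ?_
  · intro S T hS hT hF
    refine exists_component (G := G) (fun C => ∃ j ∈ C, j ∈ K) ?_ _ ?_
    · rintro A B - - ⟨j, hj, hjK⟩
      exact (Finset.mem_union.1 hj).imp (fun hj => ⟨j, hj, hjK⟩) fun hj => ⟨j, hj, hjK⟩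
    · have hp := parity S T hS hT hF
      by_contra! hno
      have heq : S ∩ K = T ∩ K := by
        ext x
        have := hno x
        simp only [Finset.mem_symmDiff, Finset.mem_inter] at this ⊢
        tauto
      rw [heq] at hp
      omega
  · rintro S T C hS hT hF ⟨hC, hcl, ⟨j, hjC, hjK⟩, hcard⟩
    have hp := parity S T hS hT hF
    have hC' : C ⊆ symmDiff T S := symmDiff_comm S T ▸ hC
    have he := crossEdges_self_of_subset_symmDiff hS hT hC
    have hS' := hS.mono (Finset.inter_subset_left (s₂ := C))
    have hT' := hT.mono (Finset.inter_subset_left (s₂ := C))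
    have l1 := hcf.crossEdges_le hT' (S ∩ C)
    have l2 := hcf.crossEdges_le hS' (T ∩ C)
    rw [crossEdges_comm] at l2
    have hCc := card_symmDiff_eq hC
    have hCc' := card_symmDiff_eq hC'
    have hsum := card_inter_add_card_inter hC
    have disj : ∀ R : Finset V, (R ∩ K).card = 0 → Disjoint (R ∩ C) K := fun R hR =>
      Finset.disjoint_of_subset_left Finset.inter_subset_left
        (Finset.disjoint_iff_inter_eq_empty.2 (Finset.card_eq_zero.1 hR))
    have pos : ∀ R : Finset V, j ∈ R → 0 < (R ∩ K).card := fun R hR =>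
      Finset.card_pos.2 ⟨j, Finset.mem_inter.2 ⟨hR, hjK⟩⟩
    have hpath : crossEdges G (S ∩ C) (T ∩ C) + 1 = (S ∩ C).card + (T ∩ C).card := by
      rcases Finset.mem_symmDiff.1 (hC hjC) with hj | hj
      · have := pos S hj.1
        have := hcf.crossEdges_lt hK hT' (disj T (by omega))
          (Finset.mem_inter.2 ⟨hj.1, hjC⟩) hjK
        omega
      · have := pos T hj.1
        have := hcf.crossEdges_lt hK hS' (disj S (by omega))
          (Finset.mem_inter.2 ⟨hj.1, hjC⟩) hjK
        rw [crossEdges_comm] at this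
        omega
    have hw : (-u) ^ (symmDiff S C).card * u ^ (symmDiff T C).card *
        (-1) ^ crossEdges G (S ∩ C) (T ∩ C) = -((-u) ^ S.card * u ^ T.card) := by
      have hexp : (symmDiff S C).card + (symmDiff T C).card = S.card + T.card := by omega
      have hsgn : (-1 : ℂ) ^ ((symmDiff S C).card + crossEdges G (S ∩ C) (T ∩ C)) =
          (-1) ^ (S.card + 1) := by
        rw [neg_one_pow_eq_pow_mod_two, neg_one_pow_eq_pow_mod_two (n := S.card + 1)]
        congr 1
        omega
      calc _ = (-1) ^ ((symmDiff S C).card + crossEdges G (S ∩ C) (T ∩ C)) *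
            u ^ ((symmDiff S C).card + (symmDiff T C).card) := by
            rw [neg_pow u, pow_add, pow_add]; ring
        _ = _ := by rw [hsgn, hexp, neg_pow u, pow_add, pow_add]; ring
    rw [hProd_symmDiff_mul hanti hcomm hS hT hC hcl, mul_smul_comm, smul_mul_assoc, ← smul_sub,
      smul_smul, hw, neg_smul]

end Operator

/-- The anticommutation identity established in the proof of Lemma 18:
`(T_G(−u)·χ·T_G(u))·χ + χ·(T_G(−u)·χ·T_G(u))
  = 2·(2·T_{G∖K_s}(u)·T_{G∖K_s}(−u) − T_G(u)·T_G(−u))`. -/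
theorem anticommutation_identity {V : Type u} [Fintype V] [DecidableEq V]
    (G : SimpleGraph V) (hcf : ClawFree G) (d : ℕ) (hd : 0 < d)
    (h : V → Matrix (Fin d) (Fin d) ℂ) (b : V → ℝ) (hb : ∀ v, b v ≠ 0)
    (hsq : ∀ v, h v * h v = ((b v : ℂ)) ^ 2 • (1 : Matrix (Fin d) (Fin d) ℂ))
    (hanti : ∀ u v, G.Adj u v → h u * h v = -(h v * h u))
    (hcomm : ∀ u v, u ≠ v → ¬ G.Adj u v → h u * h v = h v * h u)
    (Ks : Finset V) (hKs : IsSimplicialClique G Ks)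
    (χ : Matrix (Fin d) (Fin d) ℂ) (hχsq : χ * χ = 1)
    (hχanti : ∀ j ∈ Ks, χ * h j = -(h j * χ))
    (hχcomm : ∀ v : V, v ∉ Ks → χ * h v = h v * χ)
    (u : ℂ) :
    (transferOp G h Finset.univ (-u) * χ * transferOp G h Finset.univ u) * χ +
        χ * (transferOp G h Finset.univ (-u) * χ * transferOp G h Finset.univ u) =
      (2 : ℂ) • ((2 : ℂ) •
          (transferOp G h (Finset.univ \ Ks) u * transferOp G h (Finset.univ \ Ks) (-u)) -
        transferOp G h Finset.univ u * transferOp G h Finset.univ (-u)) := by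
  have hA := two_smul_transferOp_sdiff hcomm hKs hχsq hχanti hχcomm u
  have hA' := two_smul_transferOp_sdiff hcomm hKs hχsq hχanti hχcomm (-u)
  have hAc := transferOp_commute hcf hanti hcomm (Finset.univ \ Ks) u (-u)
  have hTc := transferOp_commute hcf hanti hcomm Finset.univ u (-u)
  have heven := mode_conj_transferOp_mul hcf hanti hcomm hKs hχsq hχanti hχcomm u
  generalize transferOp G h Finset.univ u = T at *
  generalize transferOp G h Finset.univ (-u) = T' at *
  generalize transferOp G h (Finset.univ \ Ks) u = A at *
  generalize transferOp G h (Finset.univ \ Ks) (-u) = A' at *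
  have conj : ∀ X Y, (χ * X * χ) * (χ * Y * χ) = χ * (X * Y) * χ := fun X Y => by
    rw [show (χ * X * χ) * (χ * Y * χ) = χ * X * (χ * χ) * Y * χ by simp only [mul_assoc], hχsq]
    simp only [mul_assoc, mul_one]
  have e2 : (4 : ℂ) • (A * A') = (T' + χ * T' * χ) * (T + χ * T * χ) := by
    rw [hAc, ← hA, ← hA', smul_mul_smul_comm]
    norm_num
  have o2 : χ * T' * χ * (χ * T * χ) = T * T' := by rw [conj, ← hTc, heven]
  rw [add_mul, mul_add, mul_add, o2, ← hTc] at e2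
  have e3 : T' * χ * T * χ + χ * (T' * χ * T) = (4 : ℂ) • (A * A') - (2 : ℂ) • (T * T') := by
    rw [e2]
    simp only [two_smul, mul_assoc]
    abel
  rw [e3, smul_sub, smul_smul]
  norm_num
end

section
/- Let d be a positive integer, let H, χ ∈ M_d(ℂ), and define the linear map D : M_d(ℂ) → M_d(ℂ) by D(x) = i·(H·x − x·H). Suppose there are complex scalars c_k, k ≥ 0, such that χ·D^k(χ) + D^k(χ)·χ = c_k·1 for every k ≥ 0. Then for all j, k ≥ 0: D^j(χ)·D^k(χ) + D^k(χ)·D^j(χ) = (−1)^j·c_{j+k}·1. (The inductive anticommutation relation established in the proof of Corollary 9.) -/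
/-- If a scalar multiple of the identity is the anticommutator of `a` and `b`, then an inner
derivation `x ↦ t • (h * x - x * h)` can be moved from `a` to `b` at the cost of a sign. -/
theorem anticommutator_commutator_left {R A : Type*} [CommRing R] [Ring A] [Algebra R A]
    (h a b : A) (t r : R) (hab : a * b + b * a = r • (1 : A)) :
    (t • (h * a - a * h)) * b + b * (t • (h * a - a * h)) =
      -(a * (t • (h * b - b * h)) + (t • (h * b - b * h)) * a) := by
  have hcomm : h * (a * b + b * a) = (a * b + b * a) * h := by
    rw [hab, mul_smul_comm, smul_mul_assoc, mul_one, one_mul]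
  have hzero : (h * a - a * h) * b + b * (h * a - a * h) =
      -(a * (h * b - b * h) + (h * b - b * h) * a) := by
    rw [← sub_eq_zero] at hcomm ⊢
    rw [← hcomm]
    noncomm_ring
  simp only [smul_mul_assoc, mul_smul_comm, ← smul_add, ← smul_neg, hzero]

/-- The inductive anticommutation relation established in the proof of Corollary 9: if the
operators `D^k(χ)`, obtained from `χ` by repeated application of the adjoint map
`D(x) = i·(H·x − x·H)`, satisfy `χ·D^k(χ) + D^k(χ)·χ = c_k·1` for all `k`, then
`D^j(χ)·D^k(χ) + D^k(χ)·D^j(χ) = (−1)^j·c_{j+k}·1` for all `j, k`. -/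
theorem iterated_adjoint_anticommutation (d : ℕ) (hd : 0 < d)
    (H χ : Matrix (Fin d) (Fin d) ℂ)
    (D : Matrix (Fin d) (Fin d) ℂ → Matrix (Fin d) (Fin d) ℂ)
    (hD : ∀ x, D x = Complex.I • (H * x - x * H))
    (c : ℕ → ℂ)
    (hc : ∀ k : ℕ, χ * D^[k] χ + D^[k] χ * χ = c k • (1 : Matrix (Fin d) (Fin d) ℂ)) :
    ∀ j k : ℕ,
      D^[j] χ * D^[k] χ + D^[k] χ * D^[j] χ =
        ((-1 : ℂ) ^ j * c (j + k)) • (1 : Matrix (Fin d) (Fin d) ℂ) := by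
  intro j
  induction j with
  | zero => intro k; simpa using hc k
  | succ j ih =>
    intro k
    have hstep := anticommutator_commutator_left H _ _ Complex.I _ (ih k)
    rw [← hD, ← hD, ← Function.iterate_succ_apply' D j, ← Function.iterate_succ_apply' D k,
      ih (k + 1)] at hstep
    rw [hstep, ← neg_smul, pow_succ, show j + (k + 1) = j + 1 + k by omega]
    congr 1
    ring
end
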